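/- Let μ be a nonnegative Radon measure on ℝⁿ, p₁,…,p_m ∈ (1,∞), 1/p = 1/p₁+⋯+1/p_m, 0 < p ≤ p₀ < n/α, 0 < p ≤ 1, and 0 < α < mn. Then ‖I_α^D(f⃗)‖_{M_μ^{p,p₀}} ≲ ‖μ‖_{n−αp}^{1/p} ‖f⃗‖_{M^{P⃗,p₀}}. -/

import Mathlib

open MeasureTheory ENNReal

noncomputable section

variable {n : ℕ}

/-- Axis-parallel cube with lower corner `a` and side length `r` (half-open). -/
def cube (a : Fin n → ℝ) (r : ℝ) : Set (Fin n → ℝ) :=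
  {y | ∀ i, a i ≤ y i ∧ y i < a i + r}

/-- The dyadic cube `2^{-k}(m + [0,1)^n)`. -/
def dyadicCube (k : ℤ) (mv : Fin n → ℤ) : Set (Fin n → ℝ) :=
  cube (fun i => (mv i : ℝ) * (2 : ℝ) ^ (-k)) ((2 : ℝ) ^ (-k))

/-- The concentric triple `3Q` of the cube with corner `a` and side `r`. -/
def tripleCube (a : Fin n → ℝ) (r : ℝ) : Set (Fin n → ℝ) :=
  cube (fun i => a i - r) (3 * r)

/-- The Morrey norm `‖f‖_{M^{p,p₀}}`. -/
def morreyNorm (p p0 : ℝ) (f : (Fin n → ℝ) → ℝ) : ℝ≥0∞ :=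
  ⨆ (a : Fin n → ℝ) (r : ℝ) (_ : 0 < r),
    volume (cube a r) ^ (1 / p0 - 1 / p) *
      (∫⁻ x in cube a r, ENNReal.ofReal |f x| ^ p) ^ (1 / p)

/-- The product Morrey norm `‖f⃗‖_{M^{P⃗,p₀}}`. -/
def prodMorreyNorm {m : ℕ} (P : Fin m → ℝ) (p p0 : ℝ)
    (f : Fin m → (Fin n → ℝ) → ℝ) : ℝ≥0∞ :=
  ⨆ (a : Fin n → ℝ) (r : ℝ) (_ : 0 < r),
    volume (cube a r) ^ (1 / p0 - 1 / p) *
      ∏ j, (∫⁻ x in cube a r, ENNReal.ofReal |f j x| ^ P j) ^ (1 / P j)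

/-- The Radon–Morrey norm `‖g‖_{M_μ^{q,q₀}}`. -/
def radonMorreyNorm (μ : Measure (Fin n → ℝ)) (q q0 : ℝ)
    (g : (Fin n → ℝ) → ℝ≥0∞) : ℝ≥0∞ :=
  ⨆ (a : Fin n → ℝ) (r : ℝ) (_ : 0 < r),
    volume (cube a r) ^ (1 / q0 - 1 / q) * (∫⁻ x in cube a r, g x ^ q ∂μ) ^ (1 / q)

/-- The growth norm `‖μ‖_β := sup_Q μ(Q)/ℓ_Q^β`. -/
def measureGrowthNorm (μ : Measure (Fin n → ℝ)) (β : ℝ) : ℝ≥0∞ :=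
  ⨆ (a : Fin n → ℝ) (r : ℝ) (_ : 0 < r), μ (cube a r) / ENNReal.ofReal r ^ β

/-- The `m`-sublinear fractional maximal operator `𝔐_α`. -/
def fracMaximal {m : ℕ} (α : ℝ) (f : Fin m → (Fin n → ℝ) → ℝ)
    (x : Fin n → ℝ) : ℝ≥0∞ :=
  ⨆ (a : Fin n → ℝ) (r : ℝ) (_ : 0 < r) (_ : x ∈ cube a r),
    ENNReal.ofReal r ^ (α - (m : ℝ) * n) *
      ∏ j, ∫⁻ y in cube a r, ENNReal.ofReal |f j y|

/-- The dyadic `m`-sublinear fractional maximal operator `𝔐_α^𝒟`. -/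
def dyadicFracMaximal {m : ℕ} (α : ℝ) (f : Fin m → (Fin n → ℝ) → ℝ)
    (x : Fin n → ℝ) : ℝ≥0∞ :=
  ⨆ (k : ℤ) (mv : Fin n → ℤ) (_ : x ∈ dyadicCube k mv),
    ENNReal.ofReal ((2 : ℝ) ^ (-k)) ^ (α - (m : ℝ) * n) *
      ∏ j, ∫⁻ y in dyadicCube k mv, ENNReal.ofReal |f j y|

/-- The dyadic `m`-linear fractional integral operator `ℑ_α^𝒟`. -/
def dyadicFracIntegral {m : ℕ} (α : ℝ) (f : Fin m → (Fin n → ℝ) → ℝ)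
    (x : Fin n → ℝ) : ℝ≥0∞ :=
  ∑' qk : ℤ × (Fin n → ℤ),
    (dyadicCube qk.1 qk.2).indicator
      (fun _ => ENNReal.ofReal ((2 : ℝ) ^ (-qk.1)) ^ (α - (m : ℝ) * n) *
        ∏ j, ∫⁻ y in dyadicCube qk.1 qk.2, ENNReal.ofReal |f j y|) x

/-- The `m`-linear fractional integral operator `ℑ_α` (with Euclidean distances). -/
def fracIntegral {m : ℕ} (α : ℝ) (f : Fin m → (Fin n → ℝ) → ℝ)
    (x : Fin n → ℝ) : ℝ≥0∞ :=
  ∫⁻ y : Fin m → Fin n → ℝ,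
    (∏ j, ENNReal.ofReal |f j (y j)|) /
      ENNReal.ofReal ((∑ j, Real.sqrt (∑ i, (x i - y j i) ^ 2)) ^ ((m : ℝ) * n - α))



/-- Powers of two in `ℝ≥0∞` with real exponent. -/
def tw (x : ℝ) : ℝ≥0∞ := (2 : ℝ≥0∞) ^ x

lemma tw_add (x y : ℝ) : tw (x + y) = tw x * tw y :=
  ENNReal.rpow_add x y (by norm_num) (by norm_num)

lemma tw_rpow (x y : ℝ) : tw x ^ y = tw (x * y) := (ENNReal.rpow_mul 2 x y).symm

lemma tw_pos (x : ℝ) : 0 < tw x := ENNReal.rpow_pos (by norm_num) (by norm_num)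

lemma tw_ne_zero (x : ℝ) : tw x ≠ 0 := (tw_pos x).ne'

lemma tw_ne_top (x : ℝ) : tw x ≠ ∞ := ENNReal.rpow_ne_top_of_ne_zero (by norm_num) (by norm_num)

lemma tw_mono {x y : ℝ} (h : x ≤ y) : tw x ≤ tw y :=
  ENNReal.rpow_le_rpow_of_exponent_le (by norm_num) h

lemma tw_lt {x y : ℝ} (h : x < y) : tw x < tw y :=
  ENNReal.rpow_lt_rpow_of_exponent_lt (by norm_num) (by norm_num) h

lemma tw_zero : tw 0 = 1 := ENNReal.rpow_zero

lemma tw_one : tw 1 = 2 := ENNReal.rpow_one _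

lemma tw_lt_iff {x y : ℝ} : tw x < tw y ↔ x < y :=
  ⟨fun h => by by_contra h'; exact absurd (tw_mono (not_lt.1 h')) (not_le.2 h), tw_lt⟩

lemma tw_nat (x : ℝ) (N : ℕ) : tw (N * x) = tw x ^ N := by
  rw [mul_comm, ← tw_rpow, ENNReal.rpow_natCast]

lemma ofReal_two_zpow (k : ℤ) : ENNReal.ofReal ((2 : ℝ) ^ k) = tw k := by
  unfold tw
  rw [← Real.rpow_intCast, ← ENNReal.ofReal_rpow_of_pos (by norm_num)]
  norm_num

/-- The geometric constant. -/
def geo (q : ℝ) : ℝ≥0∞ := ∑' N : ℕ, tw (-(N * q))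

lemma geo_ne_top {q : ℝ} (hq : 0 < q) : geo q ≠ ∞ := by
  have : geo q = ∑' N : ℕ, tw (-q) ^ N := by
    unfold geo
    congr 1; ext N
    rw [← tw_nat]; ring_nf
  rw [this, ENNReal.tsum_geometric]
  simp only [ne_eq, ENNReal.inv_eq_top, tsub_eq_zero_iff_le, not_le]
  rw [← tw_zero]
  exact tw_lt (by linarith)

lemma one_le_geo (q : ℝ) : 1 ≤ geo q := by
  unfold geo
  refine le_trans ?_ (ENNReal.le_tsum 0)
  simp [tw_zero]

lemma exists_tw {t : ℝ≥0∞} (h0 : t ≠ 0) (ht : t ≠ ∞) :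
    ∃ k : ℤ, tw k < t ∧ t ≤ tw (k + 1) := by
  have hpos : 0 < t.toReal := ENNReal.toReal_pos h0 ht
  obtain ⟨k, hk1, hk2⟩ := exists_mem_Ioc_zpow hpos (y := 2) (by norm_num)
  refine ⟨k, ?_, ?_⟩
  · rw [← ofReal_two_zpow, ENNReal.ofReal_lt_iff_lt_toReal (by positivity) ht]
    exact hk1
  · have := ofReal_two_zpow (k + 1)
    push_cast at this
    rw [← this]
    exact (ENNReal.le_ofReal_iff_toReal_le ht (by positivity)).2 hk2

/-- dyadic layer sum -/
def lay (q : ℝ) (t : ℝ≥0∞) : ℝ≥0∞ := ∑' k : ℤ, if tw k < t then tw (k * q) else 0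

lemma lay_le {q : ℝ} (hq : 0 < q) (t : ℝ≥0∞) : lay q t ≤ geo q * t ^ q := by
  rcases eq_or_ne t 0 with rfl | h0
  · simp [lay]
  rcases eq_or_ne t ∞ with rfl | ht
  · rw [ENNReal.top_rpow_of_pos hq, ENNReal.mul_top]
    · exact le_top
    · exact (zero_lt_one.trans_le (one_le_geo q)).ne'
  obtain ⟨k, hk1, hk2⟩ := exists_tw h0 ht
  have hinj : Function.Injective (fun N : ℕ => k - (N : ℤ)) := by
    intro a b h; simpa using h
  have hs : Function.support (fun k : ℤ => if tw k < t then tw (k * q) else 0) ⊆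
      Set.range (fun N : ℕ => k - (N : ℤ)) := by
    intro j hj
    have hj' : tw j < t := by
      by_contra h; simp [h] at hj
    have : (j : ℝ) < k + 1 := tw_lt_iff.1 (hj'.trans_le hk2)
    have : j < k + 1 := by exact_mod_cast this
    exact ⟨(k - j).toNat, by simp only; omega⟩
  unfold lay
  rw [← hinj.tsum_eq hs, geo, ← ENNReal.tsum_mul_right]
  refine ENNReal.tsum_le_tsum fun N => ?_
  have h1 : tw (k * q) ≤ t ^ q := by
    rw [← tw_rpow]; exact ENNReal.rpow_le_rpow hk1.le hq.le
  split_ifs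
  · refine le_trans ?_ (mul_le_mul_right h1 _)
    rw [← tw_add]
    exact tw_mono (by push_cast; linarith)
  · exact zero_le

lemma le_lay {q : ℝ} (hq : 0 < q) (t : ℝ≥0∞) : t ^ q ≤ tw q * lay q t := by
  rcases eq_or_ne t 0 with rfl | h0
  · simp [ENNReal.zero_rpow_of_pos hq]
  rcases eq_or_ne t ∞ with rfl | ht
  · have : lay q ∞ = ∞ := by
      have h1 : ∑' N : ℕ, (1 : ℝ≥0∞) ≤ lay q ∞ := by
        refine le_trans ?_ (ENNReal.tsum_comp_le_tsum_of_injective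
          (f := fun N : ℕ => (N : ℤ)) Nat.cast_injective _)
        refine ENNReal.tsum_le_tsum fun N => ?_
        rw [if_pos (tw_ne_top _).lt_top, ← tw_zero]
        exact tw_mono (by push_cast; positivity)
      rw [ENNReal.tsum_const_eq_top_of_ne_zero one_ne_zero] at h1
      exact top_le_iff.1 h1
    rw [this, ENNReal.mul_top (tw_ne_zero _)]; exact le_top
  obtain ⟨k, hk1, hk2⟩ := exists_tw h0 ht
  calc t ^ q ≤ tw (k + 1) ^ q := ENNReal.rpow_le_rpow hk2 hq.le
    _ = tw q * tw (k * q) := by rw [tw_rpow, ← tw_add]; ring_nf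
    _ ≤ tw q * lay q t := by
      gcongr
      refine le_trans ?_ (ENNReal.le_tsum k)
      rw [if_pos hk1]

lemma sum_rpow_le {ι : Type*} (s : Finset ι) (f : ι → ℝ≥0∞) {p : ℝ} (hp : 0 < p) (hp1 : p ≤ 1) :
    (∑ i ∈ s, f i) ^ p ≤ ∑ i ∈ s, f i ^ p := by
  classical
  induction s using Finset.induction with
  | empty => simp [ENNReal.zero_rpow_of_pos hp]
  | insert a s ha ih =>
    rw [Finset.sum_insert ha, Finset.sum_insert ha]
    exact (ENNReal.rpow_add_le_add_rpow _ _ hp.le hp1).trans (by gcongr)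

lemma tsum_rpow_le {ι : Type*} (f : ι → ℝ≥0∞) {p : ℝ} (hp : 0 < p) (hp1 : p ≤ 1) :
    (∑' i, f i) ^ p ≤ ∑' i, f i ^ p := by
  have h : ∑' i, f i ≤ (∑' i, f i ^ p) ^ p⁻¹ := by
    rw [ENNReal.tsum_eq_iSup_sum]
    refine iSup_le fun s => ?_
    rw [ENNReal.le_rpow_inv_iff hp]
    exact (sum_rpow_le s f hp hp1).trans (ENNReal.sum_le_tsum s)
  rwa [ENNReal.le_rpow_inv_iff hp] at h

lemma tsum_lintegral_le {X ι : Type*} [MeasurableSpace X] (μ : Measure X) (f : ι → X → ℝ≥0∞) :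
    ∑' i, ∫⁻ x, f i x ∂μ ≤ ∫⁻ x, ∑' i, f i x ∂μ := by
  classical
  rw [ENNReal.tsum_eq_iSup_sum]
  refine iSup_le fun s => ?_
  have : ∑ i ∈ s, ∫⁻ x, f i x ∂μ ≤ ∫⁻ x, ∑ i ∈ s, f i x ∂μ := by
    induction s using Finset.induction with
    | empty => simp
    | insert a s ha ih =>
      simp only [Finset.sum_insert ha]
      exact le_trans (by gcongr) (le_lintegral_add _ _)
  exact this.trans (lintegral_mono fun x => ENNReal.sum_le_tsum s)

/-- Hoelder without measurability. -/
lemma lintegral_le_holder {X : Type*} [MeasurableSpace X] (μ : Measure X) (f : X → ℝ≥0∞) {q : ℝ}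
    (hq : 1 < q) : ∫⁻ x, f x ∂μ ≤ (∫⁻ x, f x ^ q ∂μ) ^ (1 / q) * μ Set.univ ^ (1 - 1 / q) := by
  obtain ⟨g, hg, hgf, hint⟩ := exists_measurable_le_lintegral_eq μ f
  rw [hint]
  have hc : q.HolderConjugate (q / (q - 1)) := Real.HolderConjugate.conjExponent hq
  have := ENNReal.lintegral_mul_le_Lp_mul_Lq μ hc hg.aemeasurable
    (aemeasurable_const (b := (1 : ℝ≥0∞)))
  simp only [Pi.mul_apply, mul_one, ENNReal.one_rpow, lintegral_const, one_mul] at this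
  have h2 : 1 / (q / (q - 1)) = 1 - 1 / q := by
    have : q ≠ 0 := by linarith
    field_simp
  rw [h2] at this
  refine this.trans ?_
  gcongr with x
  exact hgf x

/-- index of the generation-`i` dyadic cube containing `x`. -/
def dd (i : ℤ) (x : Fin n → ℝ) : Fin n → ℤ := fun j => ⌊x j * (2 : ℝ) ^ i⌋

lemma mem_dyadicCube {i : ℤ} {v : Fin n → ℤ} {x : Fin n → ℝ} :
    x ∈ dyadicCube i v ↔ dd i x = v := by
  have h2 : (0 : ℝ) < 2 ^ i := by positivity
  simp only [dyadicCube, cube, Set.mem_ofPred_eq, dd, funext_iff, Int.floor_eq_iff, zpow_neg]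
  refine forall_congr' fun j => and_congr ?_ ?_
  · rw [← div_eq_mul_inv, div_le_iff₀ h2]
  · rw [← div_eq_mul_inv, ← one_div, ← add_div, lt_div_iff₀ h2]

lemma dyadicCube_eq (i : ℤ) (v : Fin n → ℤ) : dyadicCube i v = dd i ⁻¹' {v} := by
  ext x; simp [mem_dyadicCube]

lemma measurable_dd (i : ℤ) : Measurable (dd i : (Fin n → ℝ) → _) := by
  refine measurable_pi_lambda _ fun j => ?_
  exact Int.measurable_floor.comp ((measurable_pi_apply j).mul_const _)

lemma dd_nested {i : ℤ} (N : ℕ) {x y : Fin n → ℝ} (h : dd (i + N) x = dd (i + N) y) :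
    dd i x = dd i y := by
  have key : ∀ z : Fin n → ℝ, ∀ j, dd i z j = dd (i + N) z j / ((2 ^ N : ℕ) : ℤ) := by
    intro z j
    unfold dd
    rw [← Int.floor_div_natCast]
    congr 1
    rw [zpow_add₀ (by norm_num)]
    push_cast
    rw [zpow_natCast]
    field_simp
  ext j
  rw [key, key, h]

lemma measurableSet_cube (a : Fin n → ℝ) (r : ℝ) : MeasurableSet (cube a r) := by
  have : cube a r = Set.pi Set.univ fun i => Set.Ico (a i) (a i + r) := by
    ext y; simp [cube, Set.mem_pi]
  rw [this]
  exact MeasurableSet.univ_pi fun i => measurableSet_Ico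

lemma volume_cube (a : Fin n → ℝ) (r : ℝ) :
    volume (cube a r) = ENNReal.ofReal r ^ (n : ℝ) := by
  have : cube a r = Set.pi Set.univ fun i => Set.Ico (a i) (a i + r) := by
    ext y; simp [cube, Set.mem_pi]
  rw [this, Real.volume_pi_Ico]
  simp

lemma measurableSet_dyadicCube (i : ℤ) (v : Fin n → ℤ) : MeasurableSet (dyadicCube i v) :=
  measurableSet_cube _ _

lemma volume_dyadicCube (i : ℤ) (v : Fin n → ℤ) :
    volume (dyadicCube i v) = tw (-(i * n)) := by
  rw [dyadicCube, volume_cube, ofReal_two_zpow, tw_rpow]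
  push_cast; ring_nf

lemma saturated_le (ν ν' : Measure (Fin n → ℝ)) (c : ℝ≥0∞) (i : ℤ) (S : Set (Fin n → ℤ))
    (h : ∀ v ∈ S, ν (dyadicCube i v) ≤ c * ν' (dyadicCube i v)) :
    ν (dd i ⁻¹' S) ≤ c * ν' (dd i ⁻¹' S) := by
  have hS : dd i ⁻¹' S = ⋃ v ∈ S, dyadicCube i v := by
    ext x; simp [mem_dyadicCube]
  have hd : S.PairwiseDisjoint (dyadicCube i) := by
    intro v _ w _ hvw
    refine Set.disjoint_left.2 fun x hx hx' => hvw ?_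
    rw [mem_dyadicCube] at hx hx'
    exact hx.symm.trans hx'
  have hm : ∀ v ∈ S, MeasurableSet (dyadicCube i v) := fun v _ => measurableSet_dyadicCube i v
  rw [hS, measure_biUnion S.to_countable hd hm, measure_biUnion S.to_countable hd hm,
    ← ENNReal.tsum_mul_left]
  exact ENNReal.tsum_le_tsum fun v => h v v.2

/-- average over the dyadic cube of generation `i` with index `v` -/
def avv (i : ℤ) (g : (Fin n → ℝ) → ℝ≥0∞) (v : Fin n → ℤ) : ℝ≥0∞ :=
  tw (i * n) * ∫⁻ y in dyadicCube i v, g y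

/-- first-passage index set: for a family `F N` of functions of cubes of generation `i₀ + N`. -/
def fp (i₀ : ℤ) (F : ℕ → (Fin n → ℤ) → ℝ≥0∞) (t : ℝ≥0∞) (N : ℕ) : Set (Fin n → ℝ) :=
  {x | t < F N (dd (i₀ + N) x) ∧ ∀ N' < N, F N' (dd (i₀ + N') x) ≤ t}

/-- maximal function -/
def mx (i₀ : ℤ) (F : ℕ → (Fin n → ℤ) → ℝ≥0∞) (x : Fin n → ℝ) : ℝ≥0∞ :=
  ⨆ N, F N (dd (i₀ + N) x)

lemma measurable_F (i : ℤ) (G : (Fin n → ℤ) → ℝ≥0∞) :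
    Measurable fun x : Fin n → ℝ => G (dd i x) :=
  (measurable_from_top (f := G)).comp (by
    have : (⊤ : MeasurableSpace (Fin n → ℤ)) = MeasurableSpace.pi := by
      symm; exact eq_top_iff.2 fun s _ => s.to_countable.measurableSet
    rw [this]; exact measurable_dd i)

lemma measurable_mx (i₀ : ℤ) (F : ℕ → (Fin n → ℤ) → ℝ≥0∞) : Measurable (mx i₀ F) :=
  Measurable.iSup fun N => measurable_F (i₀ + N) (F N)

lemma fp_saturated (i₀ : ℤ) (F : ℕ → (Fin n → ℤ) → ℝ≥0∞) (t : ℝ≥0∞) (N : ℕ) :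
    fp i₀ F t N = dd (i₀ + N) ⁻¹' (dd (i₀ + N) '' fp i₀ F t N) := by
  refine Set.Subset.antisymm (Set.subset_preimage_image _ _) ?_
  rintro x ⟨y, hy, hyx⟩
  refine ⟨by rw [← hyx]; exact hy.1, fun N' hN' => ?_⟩
  have : dd (i₀ + N') x = dd (i₀ + N') y := by
    refine dd_nested (N - N') ?_
    have : i₀ + (N' : ℤ) + ((N - N' : ℕ) : ℤ) = i₀ + N := by omega
    rw [this, hyx]
  rw [this]; exact hy.2 N' hN'

lemma measurableSet_fp (i₀ : ℤ) (F : ℕ → (Fin n → ℤ) → ℝ≥0∞) (t : ℝ≥0∞) (N : ℕ) :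
    MeasurableSet (fp i₀ F t N) := by
  rw [fp_saturated]
  exact measurable_dd _ (Set.to_countable _).measurableSet

lemma fp_disjoint (i₀ : ℤ) (F : ℕ → (Fin n → ℤ) → ℝ≥0∞) (t : ℝ≥0∞) :
    Pairwise (Function.onFun Disjoint (fp i₀ F t)) := by
  intro N M h
  refine Set.disjoint_left.2 fun x hx hx' => ?_
  rcases lt_or_gt_of_ne h with h | h
  · exact absurd (hx'.2 N h) (not_le.2 hx.1)
  · exact absurd (hx.2 M h) (not_le.2 hx'.1)

lemma exists_fp {i₀ : ℤ} {F : ℕ → (Fin n → ℤ) → ℝ≥0∞} {t : ℝ≥0∞} {x : Fin n → ℝ}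
    (h : ∃ N, t < F N (dd (i₀ + N) x)) : ∃ N, x ∈ fp i₀ F t N := by
  classical
  exact ⟨Nat.find h, Nat.find_spec h, fun N' hN' => not_lt.1 (Nat.find_min h hN')⟩

lemma iUnion_fp (i₀ : ℤ) (F : ℕ → (Fin n → ℤ) → ℝ≥0∞) (t : ℝ≥0∞) :
    ⋃ N, fp i₀ F t N = {x | t < mx i₀ F x} := by
  ext x
  simp only [Set.mem_iUnion, Set.mem_ofPred_eq, mx, lt_iSup_iff]
  exact ⟨fun ⟨N, h⟩ => ⟨N, h.1⟩, exists_fp⟩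

/-- weak type bound -/
lemma weak_type (i₀ : ℤ) (g : (Fin n → ℝ) → ℝ≥0∞) (t : ℝ≥0∞) (h0 : t ≠ 0) (ht : t ≠ ∞) :
    volume {x | t < mx i₀ (fun N => avv (i₀ + N) g) x} ≤ t⁻¹ * ∫⁻ x, g x := by
  set F : ℕ → (Fin n → ℤ) → ℝ≥0∞ := fun N => avv (i₀ + N) g
  rw [← iUnion_fp, measure_iUnion (fp_disjoint _ _ _) (measurableSet_fp _ _ _)]
  calc ∑' N, volume (fp i₀ F t N) ≤ ∑' N, t⁻¹ * volume.withDensity g (fp i₀ F t N) := by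
        refine ENNReal.tsum_le_tsum fun N => ?_
        rw [fp_saturated]
        refine saturated_le _ _ _ _ _ ?_
        rintro _ ⟨x, hx, rfl⟩
        rw [withDensity_apply _ (measurableSet_dyadicCube _ _), volume_dyadicCube]
        have h1 := hx.1
        simp only [F, avv] at h1
        rw [mul_comm t⁻¹, ← div_eq_mul_inv, ENNReal.le_div_iff_mul_le (.inl h0) (.inl ht)]
        calc tw (-(((i₀ + N : ℤ) : ℝ) * n)) * t ≤ tw (-(((i₀ + N : ℤ) : ℝ) * n)) * (tw (((i₀ + N : ℤ) : ℝ) * n) *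
              ∫⁻ y in dyadicCube (i₀ + N) (dd (i₀ + N) x), g y) := by gcongr
          _ = _ := by
            rw [← mul_assoc, ← tw_add]; simp [tw_zero]
    _ = t⁻¹ * volume.withDensity g (⋃ N, fp i₀ F t N) := by
        rw [ENNReal.tsum_mul_left, measure_iUnion (fp_disjoint _ _ _) (measurableSet_fp _ _ _)]
    _ ≤ t⁻¹ * ∫⁻ x, g x := by
        gcongr
        rw [withDensity_apply _ (MeasurableSet.iUnion (measurableSet_fp _ _ _))]
        exact setLIntegral_le_lintegral _ _

lemma lintegral_eq_lay_le {q : ℝ} (hq : 0 < q) (M : (Fin n → ℝ) → ℝ≥0∞) (hM : Measurable M) :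
    ∫⁻ x, M x ^ q ≤ tw q * ∑' k : ℤ, tw (k * q) * volume {x | tw k < M x} := by
  calc ∫⁻ x, M x ^ q ≤ ∫⁻ x, tw q * ∑' k : ℤ, {x | tw k < M x}.indicator (fun _ => tw (k * q)) x := by
        refine lintegral_mono fun x => (le_lay hq (M x)).trans (le_of_eq ?_)
        simp only [lay, Set.indicator_apply, Set.mem_ofPred_eq]
    _ = _ := by
        have hs : ∀ k : ℤ, MeasurableSet {x | tw k < M x} := fun k =>
          measurableSet_lt measurable_const hM
        rw [lintegral_const_mul' _ _ (tw_ne_top _), lintegral_tsum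
          (fun k => (measurable_const.indicator (hs k)).aemeasurable)]
        congr 2; ext k
        rw [lintegral_indicator_const (hs k)]

lemma lay_le_lintegral {q : ℝ} (hq : 0 < q) (M : (Fin n → ℝ) → ℝ≥0∞) (hM : Measurable M) :
    ∑' k : ℤ, tw (k * q) * volume {x | tw k < M x} ≤ geo q * ∫⁻ x, M x ^ q := by
  calc _ = ∑' k : ℤ, ∫⁻ x, {x | tw k < M x}.indicator (fun _ => tw (k * q)) x := by
        congr 1; ext k
        rw [lintegral_indicator_const (measurableSet_lt measurable_const hM)]
    _ ≤ ∫⁻ x, ∑' k : ℤ, {x | tw k < M x}.indicator (fun _ => tw (k * q)) x := tsum_lintegral_le _ _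
    _ ≤ ∫⁻ x, geo q * M x ^ q := by
        refine lintegral_mono fun x => (le_of_eq ?_).trans (lay_le hq (M x))
        simp only [lay, Set.indicator_apply, Set.mem_ofPred_eq]
    _ = _ := lintegral_const_mul' _ _ (geo_ne_top hq)

/-- dyadic maximal theorem -/
lemma maximal (q : ℝ) (hq : 1 < q) (i₀ : ℤ) (g : (Fin n → ℝ) → ℝ≥0∞) :
    ∫⁻ x, mx i₀ (fun N => avv (i₀ + N) g) x ^ q ≤
      tw q * (tw q * geo (q - 1)) * ∫⁻ x, g x ^ q := by
  refine (lintegral_eq_lay_le (by linarith) _ (measurable_mx _ _)).trans ?_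
  rw [mul_assoc]
  gcongr
  -- truncated weak type bound
  have hw : ∀ k : ℤ, volume {x | tw k < mx i₀ (fun N => avv (i₀ + N) g) x} ≤
      tw (1 - k) * ∫⁻ x, (if tw (k - 1) < g x then g x else 0) := by
    intro k
    set g' : (Fin n → ℝ) → ℝ≥0∞ := fun x => if tw (k - 1) < g x then g x else 0
    have h1 : {x | tw k < mx i₀ (fun N => avv (i₀ + N) g) x} ⊆
        {x | tw (k - 1) < mx i₀ (fun N => avv (i₀ + N) g') x} := by
      intro x hx
      simp only [Set.mem_ofPred_eq, mx, lt_iSup_iff] at hx ⊢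
      obtain ⟨N, hN⟩ := hx
      refine ⟨N, ?_⟩
      have h2 : avv (i₀ + N) g (dd (i₀ + N) x) ≤ avv (i₀ + N) g' (dd (i₀ + N) x) + tw (k - 1) := by
        calc avv (i₀ + N) g (dd (i₀ + N) x) ≤
            tw (((i₀ + N : ℤ) : ℝ) * n) * ∫⁻ y in dyadicCube (i₀ + N) (dd (i₀ + N) x), (g' y + tw (k - 1)) := by
              unfold avv
              gcongr with y
              simp only [g']
              split_ifs with h
              · exact le_self_add
              · simpa using h
          _ = _ := by
              rw [lintegral_add_right _ measurable_const, mul_add]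
              congr 1
              rw [lintegral_const, Measure.restrict_apply_univ, volume_dyadicCube, mul_left_comm,
                ← tw_add]
              simp [tw_zero]
      by_contra hc
      rw [not_lt] at hc
      have : avv (i₀ + N) g (dd (i₀ + N) x) ≤ tw k := by
        refine h2.trans ((add_le_add_left hc _).trans (le_of_eq ?_))
        rw [← two_mul, ← tw_one, ← tw_add]; ring_nf
      exact absurd hN (not_lt.2 this)
    refine (measure_mono h1).trans ((weak_type i₀ g' _ (tw_ne_zero _) (tw_ne_top _)).trans ?_)
    gcongr
    apply le_of_eq
    unfold tw
    rw [← ENNReal.rpow_neg]; ring_nf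
  calc _ ≤ ∑' k : ℤ, ∫⁻ x, tw (k * q) * (tw (1 - k) * (if tw (k - 1) < g x then g x else 0)) := by
        refine ENNReal.tsum_le_tsum fun k => ?_
        rw [lintegral_const_mul' _ _ (tw_ne_top _), lintegral_const_mul' _ _ (tw_ne_top _)]
        gcongr
        exact hw k
    _ ≤ ∫⁻ x, ∑' k : ℤ, tw (k * q) * (tw (1 - k) * (if tw (k - 1) < g x then g x else 0)) :=
        tsum_lintegral_le _ _
    _ ≤ ∫⁻ x, tw q * geo (q - 1) * g x ^ q := by
        refine lintegral_mono fun x => ?_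
        calc ∑' k : ℤ, tw (k * q) * (tw (1 - k) * (if tw (k - 1) < g x then g x else 0))
            = ∑' k : ℤ, tw ((k + 1 : ℤ) * q) * (tw (1 - (k + 1 : ℤ)) * (if tw ((k + 1 : ℤ) - 1) < g x then g x else 0)) :=
              ((Equiv.addRight (1 : ℤ)).tsum_eq _).symm
          _ = tw q * lay (q - 1) (g x) * g x := by
              unfold lay
              rw [← ENNReal.tsum_mul_left, ← ENNReal.tsum_mul_right]
              congr 1; ext k
              push_cast
              simp only [add_sub_cancel_right]
              split_ifs
              · rw [← mul_assoc, ← tw_add, ← tw_add]; ring_nf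
              · simp
          _ ≤ tw q * (geo (q - 1) * g x ^ (q - 1)) * g x := by
              gcongr; exact lay_le (by linarith) _
          _ = tw q * geo (q - 1) * (g x ^ (q - 1) * g x ^ (1 : ℝ)) := by
              rw [ENNReal.rpow_one]; ring
          _ = _ := by
              rw [← ENNReal.rpow_add_of_nonneg _ _ (by linarith) (by norm_num)]; ring_nf
    _ = _ := lintegral_const_mul' _ _ (ENNReal.mul_ne_top (tw_ne_top _) (geo_ne_top (by linarith)))

lemma growth_le (μ : Measure (Fin n → ℝ)) (β : ℝ) (a : Fin n → ℝ) {r : ℝ} (hr : 0 < r) :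
    μ (cube a r) ≤ measureGrowthNorm μ β * ENNReal.ofReal r ^ β := by
  have h0 : ENNReal.ofReal r ≠ 0 := by simpa using hr
  have h1 : ENNReal.ofReal r ^ β ≠ 0 := (ENNReal.rpow_pos (pos_iff_ne_zero.2 h0) ofReal_ne_top).ne'
  have h2 : ENNReal.ofReal r ^ β ≠ ∞ := ENNReal.rpow_ne_top_of_ne_zero h0 ofReal_ne_top
  rw [← ENNReal.div_le_iff h1 h2]
  exact le_iSup_of_le a (le_iSup_of_le r (le_iSup_of_le hr le_rfl))

lemma growth_dyadic (μ : Measure (Fin n → ℝ)) (c : ℝ) (i : ℤ) (v : Fin n → ℤ) :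
    μ (dyadicCube i v) ≤ (measureGrowthNorm μ (n - c) * tw (i * c)) * volume (dyadicCube i v) := by
  refine (growth_le μ (n - c) _ (by positivity)).trans (le_of_eq ?_)
  rw [volume_dyadicCube, ofReal_two_zpow, tw_rpow, mul_assoc, ← tw_add]
  push_cast; ring_nf

lemma pointwise_small {α : ℝ} (i₀ : ℤ) (F : ℕ → (Fin n → ℤ) → ℝ≥0∞) (t : ℝ≥0∞)
    (x : Fin n → ℝ) :
    ∑' N : ℕ, (if t < F N (dd (i₀ + N) x) then tw (-((i₀ + N : ℤ) * α)) else 0) ≤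
      geo α * ∑' N : ℕ, (fp i₀ F t N).indicator (fun _ => tw (-((i₀ + N : ℤ) * α))) x := by
  by_cases h : ∃ N, t < F N (dd (i₀ + N) x)
  · obtain ⟨M, hM⟩ := exists_fp h
    have h1 : tw (-((i₀ + M : ℤ) * α)) ≤
        ∑' N : ℕ, (fp i₀ F t N).indicator (fun _ => tw (-((i₀ + N : ℤ) * α))) x := by
      refine le_trans ?_ (ENNReal.le_tsum M)
      rw [Set.indicator_of_mem hM]
    refine le_trans ?_ (mul_le_mul_right h1 _)
    have hinj : Function.Injective (fun N : ℕ => M + N) := add_right_injective M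
    have hs : Function.support (fun N : ℕ =>
        if t < F N (dd (i₀ + N) x) then tw (-((i₀ + N : ℤ) * α)) else 0) ⊆
        Set.range (fun N : ℕ => M + N) := by
      intro j hj
      have hj' : t < F j (dd (i₀ + j) x) := by
        by_contra h; simp [h] at hj
      have : M ≤ j := by
        by_contra hc
        exact absurd (hM.2 j (not_le.1 hc)) (not_le.2 hj')
      exact ⟨j - M, by simp only; omega⟩
    rw [← hinj.tsum_eq hs, geo, ← ENNReal.tsum_mul_right]
    refine ENNReal.tsum_le_tsum fun N => ?_
    split_ifs
    · rw [← tw_add]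
      exact tw_mono (by push_cast; linarith)
    · exact zero_le
  · push Not at h
    have : ∀ N, ¬ t < F N (dd (i₀ + N) x) := fun N => not_lt.2 (h N)
    simp [this]

lemma pointwise_small' {α : ℝ} (i₀ : ℤ) (F : ℕ → (Fin n → ℤ) → ℝ≥0∞) (x : Fin n → ℝ) :
    ∑' N : ℕ, tw (-((i₀ + N : ℤ) * α)) * F N (dd (i₀ + N) x) ≤
      (2 * geo α) * ∑' k : ℤ, ∑' N : ℕ, tw k *
        (fp i₀ F (tw k) N).indicator (fun _ => tw (-((i₀ + N : ℤ) * α))) x := by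
  calc _ ≤ ∑' N : ℕ, tw (-((i₀ + N : ℤ) * α)) * (2 * lay 1 (F N (dd (i₀ + N) x))) := by
        refine ENNReal.tsum_le_tsum fun N => ?_
        gcongr
        have := le_lay one_pos (F N (dd (i₀ + N) x))
        rwa [ENNReal.rpow_one, tw_one] at this
    _ = 2 * ∑' k : ℤ, tw k * ∑' N : ℕ,
          (if tw k < F N (dd (i₀ + N) x) then tw (-((i₀ + N : ℤ) * α)) else 0) := by
        simp only [lay, ← ENNReal.tsum_mul_left]
        rw [ENNReal.tsum_comm]
        congr 1; ext k; congr 1; ext N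
        split_ifs
        · rw [mul_one]; ring
        · simp
    _ ≤ 2 * ∑' k : ℤ, tw k * (geo α * ∑' N : ℕ,
          (fp i₀ F (tw k) N).indicator (fun _ => tw (-((i₀ + N : ℤ) * α))) x) := by
        gcongr with k
        exact pointwise_small i₀ F _ x
    _ = _ := by
        simp only [← ENNReal.tsum_mul_left]
        congr 1; ext k; congr 1; ext N
        ring

lemma trace_small (μ : Measure (Fin n → ℝ)) {α p : ℝ} (hα : 0 < α) (hp : 0 < p) (hp1 : p ≤ 1)
    (i₀ : ℤ) (F : ℕ → (Fin n → ℤ) → ℝ≥0∞) :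
    ∫⁻ x, (∑' N : ℕ, tw (-((i₀ + N : ℤ) * α)) * F N (dd (i₀ + N) x)) ^ p ∂μ ≤
      ((2 * geo α) ^ p * geo p) * (measureGrowthNorm μ (n - α * p) * ∫⁻ x, mx i₀ F x ^ p) := by
  set K := measureGrowthNorm μ (n - α * p)
  have hC : (2 * geo α) ^ p ≠ ∞ :=
    ENNReal.rpow_ne_top_of_nonneg hp.le (ENNReal.mul_ne_top (by norm_num) (geo_ne_top hα))
  calc _ ≤ ∫⁻ x, (2 * geo α) ^ p * ∑' k : ℤ, ∑' N : ℕ,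
        (fp i₀ F (tw k) N).indicator (fun _ => tw (k * p) * tw (-((i₀ + N : ℤ) * (α * p)))) x ∂μ := by
        refine lintegral_mono fun x => ?_
        refine (ENNReal.rpow_le_rpow (pointwise_small' i₀ F x) hp.le).trans ?_
        rw [ENNReal.mul_rpow_of_nonneg _ _ hp.le]
        gcongr
        refine (tsum_rpow_le _ hp hp1).trans (ENNReal.tsum_le_tsum fun k => ?_)
        refine (tsum_rpow_le _ hp hp1).trans (ENNReal.tsum_le_tsum fun N => ?_)
        by_cases hx : x ∈ fp i₀ F (tw k) N
        · simp only [Set.indicator_of_mem hx]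
          rw [ENNReal.mul_rpow_of_nonneg _ _ hp.le, tw_rpow, tw_rpow]
          apply le_of_eq; ring_nf
        · simp [Set.indicator_of_notMem hx, hp]
    _ = (2 * geo α) ^ p * ∑' k : ℤ, ∑' N : ℕ,
          tw (k * p) * tw (-((i₀ + N : ℤ) * (α * p))) * μ (fp i₀ F (tw k) N) := by
        rw [lintegral_const_mul' _ _ hC, lintegral_tsum (fun k => (Measurable.tsum fun N =>
          measurable_const.indicator (measurableSet_fp _ _ _ _)).aemeasurable)]
        congr 2; ext k
        rw [lintegral_tsum (fun N =>
          (measurable_const.indicator (measurableSet_fp _ _ _ _)).aemeasurable)]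
        congr 1; ext N
        rw [lintegral_indicator_const (measurableSet_fp _ _ _ _)]
    _ ≤ (2 * geo α) ^ p * ∑' k : ℤ, ∑' N : ℕ,
          K * (tw (k * p) * volume (fp i₀ F (tw k) N)) := by
        refine mul_le_mul_right (ENNReal.tsum_le_tsum fun k => ENNReal.tsum_le_tsum fun N => ?_) _
        have h1 : μ (fp i₀ F (tw k) N) ≤
            (K * tw ((i₀ + N : ℤ) * (α * p))) * volume (fp i₀ F (tw k) N) := by
          rw [fp_saturated]
          exact saturated_le _ _ _ _ _ fun v _ => growth_dyadic μ _ _ v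
        refine (mul_le_mul_right h1 _).trans (le_of_eq ?_)
        calc _ = K * (tw (k * p) * volume (fp i₀ F (tw k) N)) *
              (tw (-((i₀ + N : ℤ) * (α * p))) * tw ((i₀ + N : ℤ) * (α * p))) := by ring
          _ = _ := by rw [← tw_add]; simp [tw_zero]
    _ = (2 * geo α) ^ p * (K * ∑' k : ℤ, tw (k * p) * volume {x | tw k < mx i₀ F x}) := by
        congr 1
        rw [← ENNReal.tsum_mul_left]
        congr 1; ext k
        rw [ENNReal.tsum_mul_left, ENNReal.tsum_mul_left, ← iUnion_fp,
          measure_iUnion (fp_disjoint _ _ _) (measurableSet_fp _ _ _)]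
    _ ≤ (2 * geo α) ^ p * (K * (geo p * ∫⁻ x, mx i₀ F x ^ p)) := by
        gcongr
        exact lay_le_lintegral hp _ (measurable_mx _ _)
    _ = _ := by ring

/-- product maximal bound -/
lemma prod_maximal {m : ℕ} (P : Fin m → ℝ) (hP : ∀ j, 1 < P j) {p : ℝ}
    (hp : 1 / p = ∑ j, 1 / P j) (hp0 : 0 < p) (i₀ : ℤ) (g : Fin m → (Fin n → ℝ) → ℝ≥0∞) :
    ∫⁻ x, mx i₀ (fun N v => ∏ j, avv (i₀ + N) (g j) v) x ^ p ≤
      (∏ j, (tw (P j) * (tw (P j) * geo (P j - 1))) ^ (p / P j)) *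
        (∏ j, (∫⁻ x, g j x ^ P j) ^ (1 / P j)) ^ p := by
  set M : Fin m → (Fin n → ℝ) → ℝ≥0∞ := fun j => mx i₀ (fun N => avv (i₀ + N) (g j))
  have hM : ∀ x, mx i₀ (fun N v => ∏ j, avv (i₀ + N) (g j) v) x ≤ ∏ j, M j x := fun x =>
    iSup_le fun N => Finset.prod_le_prod' fun j _ =>
      le_iSup (fun N : ℕ => avv (i₀ + N) (g j) (dd (i₀ + N) x)) N
  have hPp : ∀ j, 0 < P j := fun j => by linarith [hP j]
  have hpP : ∀ j, 0 ≤ p / P j := fun j => div_nonneg hp0.le (hPp j).le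
  calc _ ≤ ∫⁻ x, ∏ j, (M j x ^ P j) ^ (p / P j) := by
        refine lintegral_mono fun x => (ENNReal.rpow_le_rpow (hM x) hp0.le).trans (le_of_eq ?_)
        rw [← ENNReal.prod_rpow_of_nonneg hp0.le]
        refine Finset.prod_congr rfl fun j _ => ?_
        rw [← ENNReal.rpow_mul, mul_div_cancel₀ _ (hPp j).ne']
    _ ≤ ∏ j, (∫⁻ x, M j x ^ P j) ^ (p / P j) := by
        refine ENNReal.lintegral_prod_norm_pow_le _
          (fun j _ => ((measurable_mx _ _).pow_const _).aemeasurable) ?_ (fun j _ => hpP j)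
        calc ∑ j, p / P j = p * ∑ j, 1 / P j := by
              rw [Finset.mul_sum]; simp [div_eq_mul_inv]
          _ = 1 := by rw [← hp]; field_simp
    _ ≤ ∏ j, ((tw (P j) * (tw (P j) * geo (P j - 1))) * ∫⁻ x, g j x ^ P j) ^ (p / P j) :=
        Finset.prod_le_prod' fun j _ => ENNReal.rpow_le_rpow (maximal _ (hP j) _ _) (hpP j)
    _ = _ := by
        rw [← ENNReal.prod_rpow_of_nonneg hp0.le, ← Finset.prod_mul_distrib]
        refine Finset.prod_congr rfl fun j _ => ?_
        rw [ENNReal.mul_rpow_of_nonneg _ _ (hpP j), ← ENNReal.rpow_mul]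
        congr 2; ring

lemma dyadicFracIntegral_eq {m : ℕ} (α : ℝ) (f : Fin m → (Fin n → ℝ) → ℝ) (x : Fin n → ℝ) :
    dyadicFracIntegral α f x = ∑' i : ℤ, tw (-(i * α)) *
      ∏ j, avv i (fun y => ENNReal.ofReal |f j y|) (dd i x) := by
  unfold dyadicFracIntegral
  rw [ENNReal.tsum_prod']
  congr 1; ext i
  rw [tsum_eq_single (dd i x)]
  · rw [Set.indicator_of_mem (mem_dyadicCube.2 rfl)]
    simp only [avv, Finset.prod_mul_distrib, Finset.prod_const, Finset.card_univ, Fintype.card_fin]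
    rw [ofReal_two_zpow, tw_rpow, ← tw_nat, ← mul_assoc, ← tw_add]
    congr 2; push_cast; ring
  · intro v hv
    exact Set.indicator_of_notMem (fun h => hv (mem_dyadicCube.1 h).symm) _

lemma tsum_split (G : ℤ → ℝ≥0∞) (i₀ : ℤ) :
    ∑' i, G i = ∑' N : ℕ, G (i₀ + N) + ∑' N : ℕ, G (i₀ - 1 - N) := by
  rw [← (Equiv.addLeft i₀).tsum_eq G, tsum_of_nat_of_neg_add_one ENNReal.summable ENNReal.summable]
  congr 1
  simp only [Equiv.coe_addLeft]
  congr 1; ext N; congr 1; ring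

lemma prod_le_morrey {m : ℕ} (P : Fin m → ℝ) (p p0 : ℝ) (f : Fin m → (Fin n → ℝ) → ℝ)
    (a : Fin n → ℝ) {r : ℝ} (hr : 0 < r) :
    ∏ j, (∫⁻ x in cube a r, ENNReal.ofReal |f j x| ^ P j) ^ (1 / P j) ≤
      volume (cube a r) ^ (1 / p - 1 / p0) * prodMorreyNorm P p p0 f := by
  have h0 : volume (cube a r) ≠ 0 := by
    rw [volume_cube]
    exact (ENNReal.rpow_pos (by simpa using hr) ofReal_ne_top).ne'
  have h1 : volume (cube a r) ≠ ∞ := by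
    rw [volume_cube]
    exact ENNReal.rpow_ne_top_of_ne_zero (by simpa using hr) ofReal_ne_top
  have h : volume (cube a r) ^ (1 / p0 - 1 / p) *
      ∏ j, (∫⁻ x in cube a r, ENNReal.ofReal |f j x| ^ P j) ^ (1 / P j) ≤ prodMorreyNorm P p p0 f :=
    le_iSup_of_le a (le_iSup_of_le r (le_iSup_of_le hr le_rfl))
  refine le_trans (le_of_eq ?_) (mul_le_mul_right h _)
  rw [← mul_assoc, ← ENNReal.rpow_add _ _ h0 h1]
  simp

lemma prod_avv_le {m : ℕ} (P : Fin m → ℝ) (hP : ∀ j, 1 < P j) {p p0 : ℝ}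
    (hp : 1 / p = ∑ j, 1 / P j) (f : Fin m → (Fin n → ℝ) → ℝ) (i : ℤ) (v : Fin n → ℤ) :
    ∏ j, avv i (fun y => ENNReal.ofReal |f j y|) v ≤
      tw (i * (n / p0)) * prodMorreyNorm P p p0 f := by
  calc _ ≤ ∏ j, tw (i * n * (1 / P j)) *
        (∫⁻ x in dyadicCube i v, ENNReal.ofReal |f j x| ^ P j) ^ (1 / P j) := by
        refine Finset.prod_le_prod' fun j _ => ?_
        unfold avv
        refine (mul_le_mul_right (lintegral_le_holder _ _ (hP j)) _).trans (le_of_eq ?_)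
        rw [Measure.restrict_apply_univ, volume_dyadicCube, tw_rpow, mul_left_comm, ← tw_add,
          mul_comm]
        ring_nf
    _ = tw (i * n * (1 / p)) *
        ∏ j, (∫⁻ x in dyadicCube i v, ENNReal.ofReal |f j x| ^ P j) ^ (1 / P j) := by
        rw [Finset.prod_mul_distrib, hp, Finset.mul_sum]
        congr 1
        have : ∀ s : Finset (Fin m), ∏ j ∈ s, tw (i * n * (1 / P j)) =
            tw (∑ j ∈ s, i * n * (1 / P j)) := by
          intro s
          induction s using Finset.induction with
          | empty => simp [tw_zero]
          | insert a s ha ih => rw [Finset.prod_insert ha, Finset.sum_insert ha, tw_add, ih]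
        exact this _
    _ ≤ tw (i * n * (1 / p)) * (volume (dyadicCube i v) ^ (1 / p - 1 / p0) *
          prodMorreyNorm P p p0 f) := by
        gcongr
        exact prod_le_morrey P p p0 f _ (by positivity)
    _ = _ := by
        rw [volume_dyadicCube, tw_rpow, ← mul_assoc, ← tw_add]
        congr 2; ring

lemma same_cube_subset {a : Fin n → ℝ} {r : ℝ} {i₀ : ℤ} (hr : r ≤ (2 : ℝ) ^ (-i₀)) {x : Fin n → ℝ}
    (hx : x ∈ cube a r) (N : ℕ) :
    dyadicCube (i₀ + N) (dd (i₀ + N) x) ⊆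
      cube (fun j => a j - (2 : ℝ) ^ (-i₀)) (3 * (2 : ℝ) ^ (-i₀)) := by
  intro y hy j
  have hx' : x ∈ dyadicCube (i₀ + N) (dd (i₀ + N) x) := mem_dyadicCube.2 rfl
  have h1 := hy j
  have h2 := hx' j
  have h3 := hx j
  have h4 : (2 : ℝ) ^ (-(i₀ + N : ℤ)) ≤ (2 : ℝ) ^ (-i₀) :=
    zpow_le_zpow_right₀ (by norm_num) (by omega)
  simp only at h1 h2 h3 ⊢
  constructor <;> linarith [h1.1, h1.2, h2.1, h2.2, h3.1, h3.2]

lemma small_part {m : ℕ} (P : Fin m → ℝ) (hP : ∀ j, 1 < P j) {p p0 α : ℝ}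
    (hp : 1 / p = ∑ j, 1 / P j) (hp0 : 0 < p) (hpp0 : p ≤ p0) (hp1 : p ≤ 1) (hα : 0 < α)
    (μ : Measure (Fin n → ℝ)) (f : Fin m → (Fin n → ℝ) → ℝ) (a : Fin n → ℝ) {r : ℝ} (hr : 0 < r)
    {i₀ : ℤ} (h1 : r ≤ (2 : ℝ) ^ (-i₀)) (h2 : (2 : ℝ) ^ (-i₀) ≤ 2 * r) :
    ∫⁻ x in cube a r, (∑' N : ℕ, tw (-((i₀ + N : ℤ) * α)) *
      ∏ j, avv (i₀ + N) (fun y => ENNReal.ofReal |f j y|) (dd (i₀ + N) x)) ^ p ∂μ ≤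
    (((2 * geo α) ^ p * geo p) * (∏ j, (tw (P j) * (tw (P j) * geo (P j - 1))) ^ (p / P j)) *
      (((6 : ℝ≥0∞) ^ (n : ℝ)) ^ (1 / p - 1 / p0)) ^ p) *
      (measureGrowthNorm μ (n - α * p) *
        (volume (cube a r) ^ (1 / p - 1 / p0) * prodMorreyNorm P p p0 f) ^ p) := by
  set s : ℝ := (2 : ℝ) ^ (-i₀)
  have hs : 0 < s := by positivity
  have hd : 0 ≤ 1 / p - 1 / p0 := sub_nonneg.2 (one_div_le_one_div_of_le hp0 hpp0)
  set Q : Set (Fin n → ℝ) := cube (fun j => a j - s) (3 * s)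
  have hQ : MeasurableSet Q := measurableSet_cube _ _
  set g : Fin m → (Fin n → ℝ) → ℝ≥0∞ := fun j => Q.indicator fun y => ENNReal.ofReal |f j y|
  set F : ℕ → (Fin n → ℤ) → ℝ≥0∞ := fun N v => ∏ j, avv (i₀ + N) (g j) v
  have hcube : ∏ j, (∫⁻ x, g j x ^ P j) ^ (1 / P j) ≤
      ((6 : ℝ≥0∞) ^ (n : ℝ)) ^ (1 / p - 1 / p0) *
        (volume (cube a r) ^ (1 / p - 1 / p0) * prodMorreyNorm P p p0 f) := by
    have e : ∀ j, ∫⁻ x, g j x ^ P j = ∫⁻ x in Q, ENNReal.ofReal |f j x| ^ P j := by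
      intro j
      rw [← lintegral_indicator hQ]
      congr 1; ext x
      have : 0 < P j := by linarith [hP j]
      by_cases hx : x ∈ Q
      · simp only [g, Set.indicator_of_mem hx]
      · simp [g, Set.indicator_of_notMem hx, this]
    simp only [e]
    refine (prod_le_morrey P p p0 f _ (by positivity)).trans ?_
    rw [← mul_assoc, ← ENNReal.mul_rpow_of_nonneg _ _ hd]
    gcongr
    rw [volume_cube, volume_cube, ← ENNReal.mul_rpow_of_nonneg _ _ (by positivity)]
    gcongr
    have : (6 : ℝ≥0∞) = ENNReal.ofReal 6 := by norm_num
    rw [this, ← ENNReal.ofReal_mul (by norm_num)]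
    exact ENNReal.ofReal_le_ofReal (by linarith)
  calc _ = ∫⁻ x in cube a r, (∑' N : ℕ, tw (-((i₀ + N : ℤ) * α)) * F N (dd (i₀ + N) x)) ^ p ∂μ := by
        refine setLIntegral_congr_fun (measurableSet_cube _ _) fun x hx => ?_
        congr 2; ext N; congr 1
        refine Finset.prod_congr rfl fun j _ => ?_
        unfold avv
        congr 1
        refine setLIntegral_congr_fun (measurableSet_dyadicCube _ _) fun y hy => ?_
        simp only [g]
        rw [Set.indicator_of_mem (same_cube_subset h1 hx N hy)]
    _ ≤ ∫⁻ x, (∑' N : ℕ, tw (-((i₀ + N : ℤ) * α)) * F N (dd (i₀ + N) x)) ^ p ∂μ :=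
        setLIntegral_le_lintegral _ _
    _ ≤ _ := trace_small μ hα hp0 hp1 i₀ F
    _ ≤ ((2 * geo α) ^ p * geo p) * (measureGrowthNorm μ (n - α * p) *
          ((∏ j, (tw (P j) * (tw (P j) * geo (P j - 1))) ^ (p / P j)) *
          (((6 : ℝ≥0∞) ^ (n : ℝ)) ^ (1 / p - 1 / p0) *
        (volume (cube a r) ^ (1 / p - 1 / p0) * prodMorreyNorm P p p0 f)) ^ p)) := by
        gcongr
        refine (prod_maximal P hP hp hp0 i₀ g).trans ?_
        gcongr
    _ = _ := by
        rw [ENNReal.mul_rpow_of_nonneg (((6 : ℝ≥0∞) ^ (n : ℝ)) ^ (1 / p - 1 / p0)) _ hp0.le]; ring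

lemma large_part {m : ℕ} (P : Fin m → ℝ) (hP : ∀ j, 1 < P j) {p p0 α : ℝ}
    (hp : 1 / p = ∑ j, 1 / P j) (hδ : 0 < n / p0 - α)
    (f : Fin m → (Fin n → ℝ) → ℝ) {r : ℝ}
    {i₀ : ℤ} (h1 : r ≤ (2 : ℝ) ^ (-i₀)) (x : Fin n → ℝ) :
    ∑' N : ℕ, tw (-((i₀ - 1 - N : ℤ) * α)) *
      ∏ j, avv (i₀ - 1 - N) (fun y => ENNReal.ofReal |f j y|) (dd (i₀ - 1 - N) x) ≤
    geo (n / p0 - α) * (ENNReal.ofReal r ^ (-(n / p0 - α)) * prodMorreyNorm P p p0 f) := by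
  have hr' : tw (i₀ * (n / p0 - α)) ≤ ENNReal.ofReal r ^ (-(n / p0 - α)) := by
    have h2 : ENNReal.ofReal r ≤ tw (-i₀) := by
      have := ofReal_two_zpow (-i₀)
      push_cast at this
      rw [← this]; exact ENNReal.ofReal_le_ofReal h1
    have h3 := ENNReal.rpow_le_rpow h2 hδ.le
    rw [ENNReal.rpow_neg]
    refine le_trans (le_of_eq ?_) (ENNReal.inv_le_inv.2 h3)
    rw [← ENNReal.rpow_neg, tw_rpow]; ring_nf
  rw [geo, ← ENNReal.tsum_mul_right]
  refine ENNReal.tsum_le_tsum fun N => ?_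
  calc _ ≤ tw (-((i₀ - 1 - N : ℤ) * α)) * (tw ((i₀ - 1 - N : ℤ) * (n / p0)) *
        prodMorreyNorm P p p0 f) := by
        gcongr; exact prod_avv_le P hP hp f _ _
    _ ≤ tw (-(N * (n / p0 - α))) * tw (i₀ * (n / p0 - α)) * prodMorreyNorm P p p0 f := by
        rw [← mul_assoc, ← tw_add, ← tw_add]
        gcongr
        exact tw_mono (by push_cast; linarith)
    _ ≤ _ := by rw [mul_assoc]; gcongr

theorem statement6 (hn : 0 < n) (m : ℕ) (hm : 0 < m)
    (P : Fin m → ℝ) (hP : ∀ j, 1 < P j) (p p0 α : ℝ)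
    (hp : 1 / p = ∑ j, 1 / P j) (hp0 : 0 < p) (hpp0 : p ≤ p0)
    (hp1 : p ≤ 1) (hp0n : p0 < n / α) (hα : 0 < α) (hαmn : α < (m : ℝ) * n) :
    ∃ C : ℝ≥0∞, 0 < C ∧ C < ∞ ∧
      ∀ μ : Measure (Fin n → ℝ), IsLocallyFiniteMeasure μ →
        ∀ f : Fin m → (Fin n → ℝ) → ℝ, (∀ j x, 0 ≤ f j x) →
          radonMorreyNorm μ p p0 (dyadicFracIntegral α f) ≤
            C * measureGrowthNorm μ (n - α * p) ^ (1 / p) *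
              prodMorreyNorm P p p0 f := by
  have hp0' : 0 < p0 := hp0.trans_le hpp0
  have hδ : 0 < n / p0 - α := by
    rw [lt_div_iff₀ hα] at hp0n
    rw [sub_pos, lt_div_iff₀ hp0']; linarith
  have hd : 0 ≤ 1 / p - 1 / p0 := sub_nonneg.2 (one_div_le_one_div_of_le hp0 hpp0)
  set A : ℝ≥0∞ := ((2 * geo α) ^ p * geo p) *
    (∏ j, (tw (P j) * (tw (P j) * geo (P j - 1))) ^ (p / P j)) *
      (((6 : ℝ≥0∞) ^ (n : ℝ)) ^ (1 / p - 1 / p0)) ^ p with hA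
  set B : ℝ≥0∞ := geo (n / p0 - α) ^ p with hB
  have hAt : A ≠ ∞ := by
    refine ENNReal.mul_ne_top (ENNReal.mul_ne_top (ENNReal.mul_ne_top ?_ (geo_ne_top hp0)) ?_) ?_
    · exact ENNReal.rpow_ne_top_of_nonneg hp0.le
        (ENNReal.mul_ne_top (by norm_num) (geo_ne_top hα))
    · refine ENNReal.prod_ne_top fun j _ => ENNReal.rpow_ne_top_of_nonneg
        (div_nonneg hp0.le (by linarith [hP j])) ?_
      exact ENNReal.mul_ne_top (tw_ne_top _) (ENNReal.mul_ne_top (tw_ne_top _)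
        (geo_ne_top (by linarith [hP j])))
    · exact ENNReal.rpow_ne_top_of_nonneg hp0.le (ENNReal.rpow_ne_top_of_nonneg hd
        (ENNReal.rpow_ne_top_of_nonneg (by positivity) (by norm_num)))
  have hBt : B ≠ ∞ := ENNReal.rpow_ne_top_of_nonneg hp0.le (geo_ne_top hδ)
  have hip : 0 ≤ 1 / p := by positivity
  refine ⟨(A + B) ^ (1 / p) + 1, by positivity, ?_, ?_⟩
  · exact ENNReal.add_lt_top.2 ⟨(ENNReal.rpow_ne_top_of_nonneg hip
      (ENNReal.add_ne_top.2 ⟨hAt, hBt⟩)).lt_top, by norm_num⟩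
  intro μ _ f _
  set K := measureGrowthNorm μ (n - α * p)
  set Φ := prodMorreyNorm P p p0 f
  refine iSup_le fun a => iSup_le fun r => iSup_le fun hr => ?_
  obtain ⟨k, hk1, hk2⟩ := exists_mem_Ioc_zpow hr (y := (2 : ℝ)) (by norm_num)
  have h1 : r ≤ (2 : ℝ) ^ (-(-(k + 1))) := by rwa [neg_neg]
  have h2 : (2 : ℝ) ^ (-(-(k + 1))) ≤ 2 * r := by
    rw [neg_neg, zpow_add₀ (by norm_num), zpow_one]; linarith
  generalize -(k + 1) = i₀ at h1 h2
  have hr0 : ENNReal.ofReal r ≠ 0 := by simpa using hr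
  set V := volume (cube a r) with hV
  have hV' : V = ENNReal.ofReal r ^ (n : ℝ) := volume_cube a r
  have hV0 : V ≠ 0 := by
    rw [hV']; exact (ENNReal.rpow_pos (pos_iff_ne_zero.2 hr0) ofReal_ne_top).ne'
  have hVt : V ≠ ∞ := by
    rw [hV']; exact ENNReal.rpow_ne_top_of_ne_zero hr0 ofReal_ne_top
  have main : ∫⁻ x in cube a r, dyadicFracIntegral α f x ^ p ∂μ ≤
      (A + B) * (K * (V ^ (1 / p - 1 / p0) * Φ) ^ p) := by
    set S : (Fin n → ℝ) → ℝ≥0∞ := fun x => ∑' N : ℕ, tw (-((i₀ + N : ℤ) * α)) *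
      ∏ j, avv (i₀ + N) (fun y => ENNReal.ofReal |f j y|) (dd (i₀ + N) x) with hS
    set c := geo (n / p0 - α) * (ENNReal.ofReal r ^ (-(n / p0 - α)) * Φ) with hc
    calc _ ≤ ∫⁻ x in cube a r, (S x ^ p + c ^ p) ∂μ := by
          refine lintegral_mono fun x => ?_
          rw [dyadicFracIntegral_eq, tsum_split _ i₀]
          refine le_trans (ENNReal.rpow_le_rpow (add_le_add_right
            (large_part P hP hp hδ f h1 x) _) hp0.le) ?_
          exact ENNReal.rpow_add_le_add_rpow _ _ hp0.le hp1
      _ = ∫⁻ x in cube a r, S x ^ p ∂μ + c ^ p * μ (cube a r) := by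
          rw [lintegral_add_right _ measurable_const, lintegral_const,
            Measure.restrict_apply_univ]
      _ ≤ A * (K * (V ^ (1 / p - 1 / p0) * Φ) ^ p) + B * (K * (V ^ (1 / p - 1 / p0) * Φ) ^ p) := by
          refine add_le_add (small_part P hP hp hp0 hpp0 hp1 hα μ f a hr h1 h2) ?_
          refine (mul_le_mul_right (growth_le μ (n - α * p) a hr) _).trans (le_of_eq ?_)
          rw [hc, ENNReal.mul_rpow_of_nonneg _ _ hp0.le, ENNReal.mul_rpow_of_nonneg _ _ hp0.le,
            ENNReal.mul_rpow_of_nonneg _ _ hp0.le, hV', ← ENNReal.rpow_mul, ← ENNReal.rpow_mul,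
            ← ENNReal.rpow_mul]
          have e : ENNReal.ofReal r ^ ((n : ℝ) * ((1 / p - 1 / p0) * p)) =
              ENNReal.ofReal r ^ (-(n / p0 - α) * p) * ENNReal.ofReal r ^ (n - α * p) := by
            rw [← ENNReal.rpow_add _ _ hr0 ofReal_ne_top]
            congr 1
            field_simp
            ring
          rw [e, hB, show measureGrowthNorm μ (n - α * p) = K from rfl]; ring
      _ = _ := by rw [add_mul]
  calc _ ≤ V ^ (1 / p0 - 1 / p) * ((A + B) * (K * (V ^ (1 / p - 1 / p0) * Φ) ^ p)) ^ (1 / p) := by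
        gcongr
    _ = (A + B) ^ (1 / p) * K ^ (1 / p) * Φ * (V ^ (1 / p0 - 1 / p) * V ^ (1 / p - 1 / p0)) := by
        rw [ENNReal.mul_rpow_of_nonneg _ _ hip, ENNReal.mul_rpow_of_nonneg _ _ hip,
          ← ENNReal.rpow_mul, mul_one_div_cancel hp0.ne', ENNReal.rpow_one]
        ring
    _ = (A + B) ^ (1 / p) * K ^ (1 / p) * Φ := by
        rw [← ENNReal.rpow_add _ _ hV0 hVt]; simp
    _ ≤ _ := by
        gcongr
        exact le_self_add
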